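/- arXiv:2203.14526 — 2 statements merged into one kernel-verified Lean document; each statement's English description precedes it below -/
import Mathlib

section
/- Sklar's theorem (existence): Let μ be a Borel probability measure on ℝ^p with joint cumulative distribution function F(x₁,…,x_p) = μ{y : y₁ ≤ x₁, …, y_p ≤ x_p} and univariate marginal cumulative distribution functions F₁,…,F_p (where F_i(t) is the measure of the set {y : y_i ≤ t}). Then there exists a Borel probability measure ν on the cube [0,1]^p each of whose one-dimensional marginals is the uniform distribution on [0,1], such that for every x = (x₁,…,x_p) ∈ ℝ^p, F(x₁,…,x_p) = ν([0,F₁(x₁)] × ⋯ × [0,F_p(x_p)]). (The function C(u₁,…,u_p) = ν([0,u₁]×⋯×[0,u_p]) is called a copula of μ.) -/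
open MeasureTheory Set

section SklarAux
open Filter Topology ProbabilityTheory

lemma sk_quantile (m : Measure ℝ) [IsProbabilityMeasure m] (u : ℝ) (h0 : 0 < u) (h1 : u < 1) :
    ∃ q, (∀ x < q, m.real (Iic x) < u) ∧ u ≤ m.real (Iic q) ∧ m.real (Iio q) ≤ u := by
  set S : Set ℝ := {x | u ≤ cdf m x} with hS
  have hne : S.Nonempty := by
    obtain ⟨x, hx⟩ := ((tendsto_cdf_atTop m).eventually (lt_mem_nhds h1)).exists
    exact ⟨x, le_of_lt hx⟩
  have hbd : BddBelow S := by
    obtain ⟨x, hx⟩ := ((tendsto_cdf_atBot m).eventually (gt_mem_nhds h0)).exists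
    refine ⟨x, fun y hy => ?_⟩
    by_contra hlt
    have h2 := monotone_cdf m (le_of_lt (not_le.1 hlt))
    have h3 : u ≤ cdf m y := hy
    linarith
  have hlt : ∀ x < sInf S, cdf m x < u := by
    intro x hx
    by_contra h
    exact absurd (csInf_le hbd (not_lt.1 h : x ∈ S)) (not_le.2 hx)
  refine ⟨sInf S, fun x hx => by rw [← cdf_eq_real]; exact hlt x hx, ?_, ?_⟩
  · rw [← cdf_eq_real]
    have hc := ((cdf m).right_continuous (sInf S)).tendsto.mono_left
      (nhdsWithin_mono _ Ioi_subset_Ici_self)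
    refine ge_of_tendsto hc ?_
    filter_upwards [self_mem_nhdsWithin] with x hx
    obtain ⟨y, hy, hyx⟩ := exists_lt_of_csInf_lt hne (mem_Ioi.1 hx)
    exact le_trans hy (monotone_cdf m hyx.le)
  · have hl : Function.leftLim (cdf m) (sInf S) ≤ u := by
      refine le_of_tendsto ((monotone_cdf m).tendsto_leftLim _) ?_
      filter_upwards [self_mem_nhdsWithin] with x hx
      exact (hlt x hx).le
    have h := (cdf m).measure_Iio (tendsto_cdf_atBot m) (sInf S)
    rw [measure_cdf] at h
    rw [measureReal_def, h, sub_zero]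
    exact ENNReal.toReal_le_of_le_ofReal h0.le (ENNReal.ofReal_le_ofReal hl)

noncomputable def skU (m : Measure ℝ) (x v : ℝ) : ℝ :=
  m.real (Iio x) + v * (m.real (Iic x) - m.real (Iio x))

lemma sk_meas (m : Measure ℝ) [IsProbabilityMeasure m] :
    Measurable (fun z : ℝ × ℝ => skU m z.1 z.2) := by
  have h1 : Measurable (fun x => m.real (Iic x)) :=
    Monotone.measurable fun a b h => measureReal_mono (Iic_subset_Iic.2 h)
  have h2 : Measurable (fun x => m.real (Iio x)) :=
    Monotone.measurable fun a b h => measureReal_mono (Iio_subset_Iio h)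
  exact (h2.comp measurable_fst).add
    (measurable_snd.mul ((h1.comp measurable_fst).sub (h2.comp measurable_fst)))

lemma sk_lt (m : Measure ℝ) [IsProbabilityMeasure m] (x : ℝ) :
    m.real (Iio x) ≤ m.real (Iic x) := measureReal_mono Iio_subset_Iic_self

lemma sk_le (m : Measure ℝ) [IsProbabilityMeasure m] (x v : ℝ) (hv : v ∈ Icc (0:ℝ) 1) :
    skU m x v ≤ m.real (Iic x) := by
  have := sk_lt m x
  unfold skU
  nlinarith [hv.2]

lemma sk_ge (m : Measure ℝ) [IsProbabilityMeasure m] (x v : ℝ) (hv : v ∈ Icc (0:ℝ) 1) :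
    m.real (Iio x) ≤ skU m x v := by
  have := sk_lt m x
  unfold skU
  nlinarith [hv.1, mul_nonneg hv.1 (sub_nonneg.2 this)]

lemma sk_mem (m : Measure ℝ) [IsProbabilityMeasure m] (x v : ℝ) (hv : v ∈ Icc (0:ℝ) 1) :
    skU m x v ∈ Icc (0:ℝ) 1 :=
  ⟨measureReal_nonneg.trans (sk_ge m x v hv), (sk_le m x v hv).trans measureReal_le_one⟩

noncomputable abbrev skL : Measure ℝ := volume.restrict (Icc (0:ℝ) 1)

instance skL_prob : IsProbabilityMeasure skL := ⟨by simp [skL]⟩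

lemma skL_ae : ∀ᵐ v ∂skL, v ∈ Icc (0:ℝ) 1 := ae_restrict_mem measurableSet_Icc

lemma skL_Iio (u : ℝ) (h0 : 0 ≤ u) (h1 : u ≤ 1) : skL.real (Iio u) = u := by
  have : Iio u ∩ Icc (0:ℝ) 1 = Ico 0 u := by
    ext x; simp only [mem_inter_iff, mem_Iio, mem_Icc, mem_Ico]
    constructor
    · rintro ⟨a, b, c⟩; exact ⟨b, a⟩
    · rintro ⟨a, b⟩; exact ⟨b, a, by linarith⟩
  rw [measureReal_def, Measure.restrict_apply measurableSet_Iio, this]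
  simp [h0]

lemma sk_prodae (α : Type*) [MeasurableSpace α] (m : Measure α) [IsProbabilityMeasure m] :
    ∀ᵐ z ∂(m.prod skL), z.2 ∈ Icc (0:ℝ) 1 :=
  Measure.quasiMeasurePreserving_snd.ae skL_ae

lemma sk_prob_lt (m : Measure ℝ) [IsProbabilityMeasure m] (u : ℝ) (h0 : 0 < u) (h1 : u < 1) :
    (m.prod skL).real {z | skU m z.1 z.2 < u} = u := by
  obtain ⟨q, hq1, hq2, hq3⟩ := sk_quantile m u h0 h1
  set g := m.real (Iio q)
  have hs : m.real {q} = m.real (Iic q) - g := by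
    have : Iic q = Iio q ∪ {q} := by ext x; simp [le_iff_lt_or_eq]
    rw [this, measureReal_union (by simp) (measurableSet_singleton q)]
    ring
  set d := m.real {q}
  have hd0 : 0 ≤ d := measureReal_nonneg
  have hae : {z : ℝ × ℝ | skU m z.1 z.2 < u} =ᵐ[m.prod skL]
      ((Iio q ×ˢ univ) ∪ ({q} ×ˢ {v | g + v * d < u}) : Set (ℝ × ℝ)) := by
    filter_upwards [sk_prodae ℝ m] with z hz
    apply propext
    change skU m z.1 z.2 < u ↔ z ∈ ((Iio q ×ˢ univ) ∪ ({q} ×ˢ {v | g + v * d < u}) : Set (ℝ × ℝ))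
    obtain ⟨x, v⟩ := z
    simp only [mem_union, mem_prod, mem_Iio, mem_univ, and_true, mem_singleton_iff, mem_ofPred_eq]
    rcases lt_trichotomy x q with h | h | h
    · simp only [h, true_or, iff_true]
      exact (sk_le m x v hz).trans_lt (hq1 x h)
    · subst h
      simp [skU, hs, g]
    · have : m.real (Iic q) ≤ m.real (Iio x) :=
        measureReal_mono (fun y hy => lt_of_le_of_lt hy h)
      have h2 := sk_ge m x v hz
      simp only [not_lt.2 h.le, h.ne', false_and, or_false, iff_false, not_lt]
      linarith
  have hm : MeasurableSet {v : ℝ | g + v * d < u} :=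
    measurableSet_lt (by fun_prop) measurable_const
  rw [measureReal_congr hae, measureReal_union
    (by rw [Set.disjoint_prod]; left; simp) ((measurableSet_singleton q).prod hm),
    measureReal_prod_prod, measureReal_prod_prod]
  change g * _ + d * _ = u
  rw [probReal_univ]
  rcases hd0.eq_or_lt with h | h
  · rw [← h]; linarith
  · have : {v : ℝ | g + v * d < u} = Iio ((u - g) / d) := by
      ext v; simp only [mem_ofPred_eq, mem_Iio, lt_div_iff₀ h]
      constructor <;> intro <;> linarith
    rw [this, skL_Iio _ (div_nonneg (by linarith) hd0) (by rw [div_le_one h]; linarith)]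
    field_simp
    ring

lemma sk_unif (m : Measure ℝ) [IsProbabilityMeasure m] :
    (m.prod skL).map (fun z => skU m z.1 z.2) = skL := by
  have hM := sk_meas m
  have : IsProbabilityMeasure ((m.prod skL).map (fun z => skU m z.1 z.2)) :=
    Measure.isProbabilityMeasure_map hM.aemeasurable
  set N := (m.prod skL).map (fun z => skU m z.1 z.2) with hN
  have hNae : ∀ᵐ y ∂N, y ∈ Icc (0:ℝ) 1 := by
    rw [hN]
    refine (ae_map_iff (p := fun y => y ∈ Icc (0:ℝ) 1) hM.aemeasurable measurableSet_Icc).2 ?_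
    filter_upwards [sk_prodae ℝ m] with z hz using sk_mem m _ _ hz
  have hIio : ∀ u, 0 < u → u < 1 → N.real (Iio u) = u := by
    intro u h0 h1
    rw [hN, map_measureReal_apply hM measurableSet_Iio]
    exact sk_prob_lt m u h0 h1
  -- atoms at the right end vanish
  have key : ∀ P : Measure ℝ, IsProbabilityMeasure P → (∀ᵐ y ∂P, y ∈ Icc (0:ℝ) 1) →
      (∀ u, 0 < u → u < 1 → P.real (Iio u) = u) →
      ∀ u, P.real (Iio u) = max 0 (min u 1) := by
    intro P _ hP h u
    rcases le_or_gt u 0 with h0 | h0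
    · have : P (Iio u) = 0 := by
        refine measure_mono_null ?_ hP
        intro y hy hy'
        have := hy'.1
        have : y < u := hy
        linarith
      rw [measureReal_def, this, min_eq_left (by linarith), max_eq_left h0]; simp
    rcases lt_or_ge u 1 with h1 | h1
    · rw [h u h0 h1, min_eq_left h1.le, max_eq_right h0.le]
    · rw [min_eq_right h1, max_eq_right zero_le_one]
      refine le_antisymm measureReal_le_one ?_
      refine le_of_forall_lt fun c hc => ?_
      have hb : max c 0 < 1 := max_lt hc one_pos
      obtain ⟨b, hb1, hb2⟩ := exists_between hb
      have h3 := h b (lt_of_le_of_lt (le_max_right _ _) hb1) hb2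
      have h4 : P.real (Iio b) ≤ P.real (Iio u) :=
        measureReal_mono (Iio_subset_Iio (by linarith))
      have := le_max_left c 0
      linarith
  refine Measure.ext_of_Ici _ _ fun a => ?_
  have e : N.real (Iio a) = skL.real (Iio a) := by
    rw [key N inferInstance hNae hIio, key skL inferInstance skL_ae
      (fun u h0 h1 => skL_Iio u h0.le h1.le)]
  rw [← compl_Iio, prob_compl_eq_one_sub measurableSet_Iio, prob_compl_eq_one_sub measurableSet_Iio]
  congr 1
  exact (measureReal_eq_measureReal_iff).1 e

end SklarAux

/-- Sklar's theorem (existence): for any Borel probability measure `μ` on `ℝ^p`, there is a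
Borel probability measure `ν` concentrated on the cube `[0,1]^p`, each of whose one-dimensional
marginals is the uniform distribution on `[0,1]`, such that the joint CDF of `μ` satisfies
`F(x) = ν([0, F₁(x₁)] × ⋯ × [0, F_p(x_p)])` where `Fᵢ` are the marginal CDFs of `μ`. -/
theorem sklar_existence (p : ℕ) (μ : Measure (Fin p → ℝ)) [IsProbabilityMeasure μ] :
    ∃ ν : Measure (Fin p → ℝ), IsProbabilityMeasure ν ∧
      ν ((univ.pi fun _ : Fin p => Icc (0 : ℝ) 1)ᶜ) = 0 ∧
      (∀ i : Fin p, ν.map (fun y => y i) = volume.restrict (Icc (0 : ℝ) 1)) ∧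
      ∀ x : Fin p → ℝ,
        μ {y | ∀ i, y i ≤ x i} =
          ν (univ.pi fun i => Icc 0 ((μ {y | y i ≤ x i}).toReal)) := by
  let m : Fin p → Measure ℝ := fun i => μ.map (fun y => y i)
  have hm : ∀ i, IsProbabilityMeasure (m i) := fun i =>
    Measure.isProbabilityMeasure_map (measurable_pi_apply i).aemeasurable
  let T : (Fin p → ℝ) × ℝ → (Fin p → ℝ) := fun z i => skU (m i) (z.1 i) z.2
  have hTi : ∀ i, Measurable (fun z => T z i) := fun i =>
    (sk_meas (m i)).comp (f := fun z : (Fin p → ℝ) × ℝ => (z.1 i, z.2))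
      (((measurable_pi_apply i).comp measurable_fst).prodMk measurable_snd)
  have hT : Measurable T := measurable_pi_lambda _ hTi
  have hlaw : ∀ i, (μ.prod skL).map (fun z => T z i) = skL := by
    intro i
    have h1 : (μ.prod skL).map (Prod.map (fun y : Fin p → ℝ => y i) (id : ℝ → ℝ))
        = (m i).prod skL := by
      rw [← Measure.map_prod_map _ _ (measurable_pi_apply i) measurable_id, Measure.map_id]
    have h2 := sk_unif (m i)
    rw [← h1, Measure.map_map (sk_meas (m i)) ((measurable_pi_apply i).prodMap measurable_id)] at h2
    exact h2
  have hF : ∀ i t, (m i).real (Iic t) = (μ {y | y i ≤ t}).toReal := by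
    intro i t
    rw [map_measureReal_apply (measurable_pi_apply i) measurableSet_Iic]
    rfl
  refine ⟨(μ.prod skL).map T, Measure.isProbabilityMeasure_map hT.aemeasurable, ?_, ?_, ?_⟩
  · rw [Measure.map_apply hT (MeasurableSet.univ_pi fun _ => measurableSet_Icc).compl]
    refine measure_mono_null ?_ (sk_prodae _ μ)
    intro z hz hz2
    exact hz fun i _ => sk_mem (m i) _ _ hz2
  · intro i
    rw [Measure.map_map (measurable_pi_apply i) hT]
    exact hlaw i
  · intro x
    rw [Measure.map_apply hT (MeasurableSet.univ_pi fun _ => measurableSet_Icc)]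
    have hA : μ {y | ∀ i, y i ≤ x i} = (μ.prod skL) ({y | ∀ i, y i ≤ x i} ×ˢ univ) := by
      rw [Measure.prod_prod, measure_univ, mul_one]
    rw [hA]
    apply measure_congr
    have hi : ∀ i, ∀ᵐ z ∂(μ.prod skL), T z i ≤ (m i).real (Iic (x i)) → z.1 i ≤ x i := by
      intro i
      have hsub : ({y | y i ≤ x i} ×ˢ univ : Set ((Fin p → ℝ) × ℝ)) ≤ᵐ[μ.prod skL]
          {z | T z i ≤ (m i).real (Iic (x i))} := by
        filter_upwards [sk_prodae _ μ] with z hz hzx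
        exact (sk_le (m i) _ _ hz).trans (measureReal_mono (Iic_subset_Iic.2 hzx.1))
      have hmle : (μ.prod skL) {z | T z i ≤ (m i).real (Iic (x i))} ≤
          (μ.prod skL) ({y | y i ≤ x i} ×ˢ univ) := by
        have e1 : (μ.prod skL) {z | T z i ≤ (m i).real (Iic (x i))}
            = skL (Iic ((m i).real (Iic (x i)))) := by
          conv_rhs => rw [← hlaw i]
          rw [Measure.map_apply (hTi i) measurableSet_Iic]; rfl
        rw [e1, Measure.prod_prod, measure_univ, mul_one, Measure.restrict_apply measurableSet_Iic]
        calc _ ≤ volume (Icc 0 ((m i).real (Iic (x i)))) :=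
              measure_mono fun y hy => ⟨hy.2.1, hy.1⟩
          _ = _ := by
              rw [Real.volume_Icc, sub_zero, hF, ENNReal.ofReal_toReal (measure_ne_top _ _)]
      have hms : MeasurableSet ({y | y i ≤ x i} ×ˢ univ : Set ((Fin p → ℝ) × ℝ)) :=
        (measurableSet_le (measurable_pi_apply i) measurable_const).prod MeasurableSet.univ
      have := ae_eq_of_ae_subset_of_measure_ge hsub hmle hms.nullMeasurableSet (measure_ne_top _ _)
      filter_upwards [this] with z hz hz2
      have h3 : z ∈ ({y | y i ≤ x i} ×ˢ univ : Set ((Fin p → ℝ) × ℝ)) := Eq.mpr hz hz2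
      exact h3.1
    filter_upwards [sk_prodae _ μ, Filter.eventually_all.2 hi] with z hz hzi
    apply propext
    constructor
    · intro h i _
      refine ⟨(sk_mem (m i) _ _ hz).1, ?_⟩
      rw [← hF]
      exact (sk_le (m i) _ _ hz).trans (measureReal_mono (Iic_subset_Iic.2 (h.1 i)))
    · intro h
      refine ⟨fun i => hzi i ?_, trivial⟩
      rw [hF]
      exact (h i trivial).2
end

section
/- Sklar's theorem (uniqueness): Let μ be a Borel probability measure on ℝ^p whose marginal cumulative distribution functions F₁,…,F_p are all continuous. If ν and ν′ are two Borel probability measures on [0,1]^p, each with all one-dimensional marginals uniform on [0,1], such that for every x ∈ ℝ^p the joint CDF of μ satisfies F(x₁,…,x_p) = ν([0,F₁(x₁)]×⋯×[0,F_p(x_p)]) = ν′([0,F₁(x₁)]×⋯×[0,F_p(x_p)]), then ν = ν′. -/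
open MeasureTheory Set

lemma sk_surj (p : ℕ) (μ : Measure (Fin p → ℝ)) [IsProbabilityMeasure μ] (i : Fin p)
    (hcont : Continuous fun t : ℝ => (μ {y | y i ≤ t}).toReal) (u : ℝ) (h0 : 0 < u) (h1 : u < 1) :
    ∃ t : ℝ, (μ {y | y i ≤ t}).toReal = u := by
  have hm : Measurable (fun y : Fin p → ℝ => y i) := measurable_pi_apply i
  haveI : IsProbabilityMeasure (μ.map (fun y : Fin p → ℝ => y i)) :=
    Measure.isProbabilityMeasure_map hm.aemeasurable
  have e : ∀ t, ProbabilityTheory.cdf (μ.map (fun y : Fin p → ℝ => y i)) t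
      = (μ {y | y i ≤ t}).toReal := by
    intro t
    rw [ProbabilityTheory.cdf_eq_real, Measure.real, Measure.map_apply hm measurableSet_Iic]
    rfl
  have hb := ProbabilityTheory.tendsto_cdf_atBot (μ.map (fun y : Fin p → ℝ => y i))
  have ht := ProbabilityTheory.tendsto_cdf_atTop (μ.map (fun y : Fin p → ℝ => y i))
  obtain ⟨a, ha⟩ := (hb.eventually_lt_const h0).exists
  obtain ⟨b, hb⟩ := (ht.eventually_const_lt h1).exists
  rw [e] at ha hb
  exact mem_range_of_exists_le_of_exists_ge hcont ⟨a, ha.le⟩ ⟨b, hb.le⟩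

lemma sk_ae (p : ℕ) (ν : Measure (Fin p → ℝ))
    (hν : ∀ i : Fin p, ν.map (fun y => y i) = volume.restrict (Icc (0 : ℝ) 1)) :
    ∀ᵐ y ∂ν, ∀ i, y i ∈ Ioo (0 : ℝ) 1 := by
  rw [ae_all_iff]
  intro i
  have hm : Measurable (fun y : Fin p → ℝ => y i) := measurable_pi_apply i
  have : ∀ᵐ t ∂(ν.map (fun y => y i)), t ∈ Ioo (0 : ℝ) 1 := by
    rw [hν i, ← restrict_Ioo_eq_restrict_Icc]
    exact ae_restrict_mem measurableSet_Ioo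
  exact ae_of_ae_map hm.aemeasurable this

lemma sk_lim (p : ℕ) (ν : Measure (Fin p → ℝ))
    (hν : ∀ i : Fin p, ν.map (fun y => y i) = volume.restrict (Icc (0 : ℝ) 1))
    (a : Fin p → ℝ) :
    ν (univ.pi fun i => Iic (a i)) =
      ⨆ n : ℕ, ν (univ.pi fun i => Icc 0 (min (a i) (1 - 1 / ((n : ℝ) + 2)))) := by
  rw [← Monotone.measure_iUnion]
  · apply measure_congr
    filter_upwards [sk_ae p ν hν] with y hy
    apply propext
    change y ∈ (univ.pi fun i => Iic (a i)) ↔ y ∈ ⋃ n : ℕ, _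
    simp only [mem_iUnion, mem_pi, mem_univ, true_imp_iff, mem_Iic, mem_Icc, le_min_iff]
    constructor
    · intro h
      have : ∀ i, ∀ᶠ n : ℕ in Filter.atTop, y i ≤ 1 - 1 / ((n : ℝ) + 2) := by
        intro i
        have h1 : Filter.Tendsto (fun n : ℕ => 1 - 1 / ((n : ℝ) + 2)) Filter.atTop (nhds (1 - 0)) := by
          apply Filter.Tendsto.sub tendsto_const_nhds
          apply Filter.Tendsto.div_atTop tendsto_const_nhds
          exact Filter.tendsto_atTop_add_const_right _ _ tendsto_natCast_atTop_atTop
        exact (h1.eventually_const_lt (by simpa using (hy i).2)).mono fun _ h => h.le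
      obtain ⟨n, hn⟩ := (Filter.eventually_all.2 this).exists
      exact ⟨n, fun i => ⟨(hy i).1.le, h i, hn i⟩⟩
    · rintro ⟨n, hn⟩ i
      exact (hn i).2.1
  · intro m n hmn
    apply pi_mono
    intro i _
    apply Icc_subset_Icc_right
    have : (m : ℝ) ≤ n := by exact_mod_cast hmn
    gcongr

/-- Sklar's theorem (uniqueness): if the marginal CDFs of a Borel probability measure `μ` on
`ℝ^p` are all continuous, then any two Borel probability measures on `[0,1]^p` with uniform
one-dimensional marginals that both represent the joint CDF of `μ` via
`F(x) = ν([0, F₁(x₁)] × ⋯ × [0, F_p(x_p)])` must coincide. -/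
theorem sklar_uniqueness (p : ℕ) (μ : Measure (Fin p → ℝ)) [IsProbabilityMeasure μ]
    (hcont : ∀ i : Fin p, Continuous fun t : ℝ => (μ {y | y i ≤ t}).toReal)
    (ν ν' : Measure (Fin p → ℝ)) [IsProbabilityMeasure ν] [IsProbabilityMeasure ν']
    (hνcube : ν ((univ.pi fun _ : Fin p => Icc (0 : ℝ) 1)ᶜ) = 0)
    (hν'cube : ν' ((univ.pi fun _ : Fin p => Icc (0 : ℝ) 1)ᶜ) = 0)
    (hν : ∀ i : Fin p, ν.map (fun y => y i) = volume.restrict (Icc (0 : ℝ) 1))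
    (hν' : ∀ i : Fin p, ν'.map (fun y => y i) = volume.restrict (Icc (0 : ℝ) 1))
    (h : ∀ x : Fin p → ℝ,
      μ {y | ∀ i, y i ≤ x i} = ν (univ.pi fun i => Icc 0 ((μ {y | y i ≤ x i}).toReal)))
    (h' : ∀ x : Fin p → ℝ,
      μ {y | ∀ i, y i ≤ x i} = ν' (univ.pi fun i => Icc 0 ((μ {y | y i ≤ x i}).toReal))) :
    ν = ν' := by
  have key : ∀ u : Fin p → ℝ, (∀ i, u i < 1) →
      ν (univ.pi fun i => Icc 0 (u i)) = ν' (univ.pi fun i => Icc 0 (u i)) := by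
    intro u hu
    by_cases h0 : ∀ i, 0 < u i
    · choose x hx using fun i => sk_surj p μ i (hcont i) (u i) (h0 i) (hu i)
      have e := (h x).symm.trans (h' x)
      simpa only [hx] using e
    · push Not at h0
      obtain ⟨i, hi⟩ := h0
      have z : ∀ ρ : Measure (Fin p → ℝ),
          (∀ i : Fin p, ρ.map (fun y => y i) = volume.restrict (Icc (0 : ℝ) 1)) →
          ρ (univ.pi fun i => Icc 0 (u i)) = 0 := by
        intro ρ hρ
        refine measure_mono_null ?_ (ae_iff.1 (sk_ae p ρ hρ))
        intro y hy hc
        exact absurd ((hy i (mem_univ i)).2.trans hi) (not_le.2 (hc i).1)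
      rw [z ν hν, z ν' hν']
  have hgen : (MeasurableSpace.pi : MeasurableSpace (Fin p → ℝ)) =
      MeasurableSpace.generateFrom (univ.pi '' univ.pi fun _ : Fin p => range (Iic : ℝ → Set ℝ)) := by
    symm
    apply generateFrom_eq_pi
    · intro i
      rw [← borel_eq_generateFrom_Iic]
      exact (BorelSpace.measurable_eq (α := ℝ)).symm
    · intro i
      refine ⟨fun n : ℕ => Iic (n : ℝ), fun n => mem_range_self _, ?_⟩
      ext x
      simpa using exists_nat_ge x
  refine ext_of_generate_finite _ hgen (IsPiSystem.pi fun _ => ?_) ?_ (by simp)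
  · simpa using isPiSystem_image_Iic (univ : Set ℝ)
  · rintro _ ⟨s, hs, rfl⟩
    choose a ha using fun i => hs i (mem_univ i)
    obtain rfl : (fun i => Iic (a i)) = s := funext ha
    rw [sk_lim p ν hν, sk_lim p ν' hν']
    congr 1
    ext1 n
    apply key
    intro i
    refine lt_of_le_of_lt (min_le_right _ _) ?_
    have : (0 : ℝ) < 1 / ((n : ℝ) + 2) := by positivity
    linarith
end
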